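/- arXiv:1310.0139 — 17 statements merged into one kernel-verified Lean document; each statement's English description precedes it below -/
import Mathlib

section
/- Let a, b ∈ ℝ with b ≠ 0, and let f : ℝ × ℝ → ℝ. Suppose u : ℝ × ℝ → ℝ is twice continuously differentiable and satisfies the generalized Heath equation u_t(x,t) = a·u_x(x,t) + (1/2)·u_x(x,t)² − (1/2)·b²·u_xx(x,t) + f(x, u(x,t)) for all (x,t) ∈ ℝ². Define φ : ℝ × ℝ → ℝ by φ(x,τ) = exp(−(a·x + u(x, −2τ/b²))/b²), and define F : ℝ × (0,∞) → ℝ by F(x,v) = (v/b⁴)·(2·f(x, −b²·log v − a·x) − a²). Then φ(x,τ) > 0 for all (x,τ) and φ satisfies the heat equation with nonlinear source φ_τ(x,τ) = φ_xx(x,τ) + F(x, φ(x,τ)) for all (x,τ) ∈ ℝ². -/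
/-- The point transformation φ = exp(−(ax+u)/b²), τ = −b²t/2 maps solutions of
the generalized Heath equation to positive solutions of the heat equation with nonlinear
source φ_τ = φ_xx + F(x,φ). -/
theorem heath_to_heat_with_source
    (a b : ℝ) (hb : b ≠ 0) (f : ℝ → ℝ → ℝ) (u : ℝ → ℝ → ℝ)
    (hu : ContDiff ℝ 2 (Function.uncurry u))
    (heq : ∀ x t : ℝ, deriv (u x) t =
      a * deriv (fun y => u y t) x + (1/2) * (deriv (fun y => u y t) x)^2
        - (1/2) * b^2 * deriv (deriv (fun y => u y t)) x + f x (u x t))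
    (φ : ℝ → ℝ → ℝ)
    (hφ : ∀ x τ : ℝ, φ x τ = Real.exp (-(a * x + u x (-2 * τ / b^2)) / b^2))
    (F : ℝ → ℝ → ℝ)
    (hF : ∀ x v : ℝ, 0 < v →
      F x v = (v / b^4) * (2 * f x (-b^2 * Real.log v - a * x) - a^2)) :
    (∀ x τ : ℝ, 0 < φ x τ) ∧
    (∀ x τ : ℝ, deriv (φ x) τ = deriv (deriv (fun y => φ y τ)) x + F x (φ x τ)) := by
  have hpos : ∀ x τ : ℝ, 0 < φ x τ := fun x τ => by rw [hφ]; exact Real.exp_pos _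
  refine ⟨hpos, fun x τ => ?_⟩
  have hut : DifferentiableAt ℝ (u x) (-2 * τ / b ^ 2) := by
    have h : ContDiff ℝ 2 (u x) := hu.comp (contDiff_prodMk_right x)
    exact h.differentiable (by norm_num) _
  have hux : ContDiff ℝ 2 (fun y => u y (-2 * τ / b ^ 2)) :=
    hu.comp (contDiff_prodMk_left (-2 * τ / b ^ 2))
  have hdx : Differentiable ℝ (fun y => u y (-2 * τ / b ^ 2)) := hux.differentiable (by norm_num)
  have hdxx : Differentiable ℝ (deriv fun y => u y (-2 * τ / b ^ 2)) :=
    hux.differentiable_deriv_two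
  have hφτ : HasDerivAt (φ x)
      (φ x τ * (-(deriv (u x) (-2 * τ / b ^ 2) * (-2 / b ^ 2)) / b ^ 2)) τ := by
    have hs : HasDerivAt (fun s : ℝ => -2 * s / b ^ 2) (-2 / b ^ 2) τ := by
      simpa using ((hasDerivAt_id τ).const_mul (-2)).div_const (b ^ 2)
    rw [hφ x τ, funext (hφ x)]
    exact (((hut.hasDerivAt.comp τ hs).const_add (a * x)).neg.div_const (b ^ 2)).exp
  have hφx : ∀ y, HasDerivAt (fun y => φ y τ)
      (φ y τ * (-(a + deriv (fun y => u y (-2 * τ / b ^ 2)) y) / b ^ 2)) y := fun y => by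
    have hl : HasDerivAt (fun y : ℝ => a * y) a y := by
      simpa using (hasDerivAt_id y).const_mul a
    rw [hφ y τ, funext fun y => hφ y τ]
    exact ((hl.add (hdx y).hasDerivAt).neg.div_const (b ^ 2)).exp
  have hφxx : HasDerivAt
      (fun y => φ y τ * (-(a + deriv (fun y => u y (-2 * τ / b ^ 2)) y) / b ^ 2))
      (φ x τ * (-(a + deriv (fun y => u y (-2 * τ / b ^ 2)) x) / b ^ 2) *
          (-(a + deriv (fun y => u y (-2 * τ / b ^ 2)) x) / b ^ 2) +
        φ x τ * (-deriv (deriv fun y => u y (-2 * τ / b ^ 2)) x / b ^ 2)) x :=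
    (hφx x).mul (((hdxx x).hasDerivAt.const_add a).neg.div_const (b ^ 2))
  have hlog : -b ^ 2 * Real.log (φ x τ) - a * x = u x (-2 * τ / b ^ 2) := by
    rw [hφ, Real.log_exp]
    field_simp
    ring
  rw [hφτ.deriv, funext fun y => (hφx y).deriv, hφxx.deriv, hF x _ (hpos x τ), hlog,
    heq]
  field_simp
  ring
end

section
/- Let a, b ∈ ℝ with b ≠ 0, and let F : ℝ × ℝ → ℝ. Suppose φ : ℝ × ℝ → ℝ is twice continuously differentiable, φ(x,τ) > 0 for all (x,τ), and φ satisfies φ_τ(x,τ) = φ_xx(x,τ) + F(x, φ(x,τ)) for all (x,τ) ∈ ℝ². Define u : ℝ × ℝ → ℝ by u(x,t) = −b²·log φ(x, −b²·t/2) − a·x, and define f : ℝ × ℝ → ℝ by f(x,w) = (b⁴/2)·exp((a·x + w)/b²)·F(x, exp(−(a·x + w)/b²)) + a²/2. Then u satisfies the generalized Heath equation u_t(x,t) = a·u_x(x,t) + (1/2)·u_x(x,t)² − (1/2)·b²·u_xx(x,t) + f(x, u(x,t)) for all (x,t) ∈ ℝ². -/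
/-- A positive solution of the heat equation with nonlinear source transforms,
via u = −b²·log φ(x, −b²t/2) − ax, into a solution of the generalized Heath equation. -/
theorem heat_with_source_to_heath
    (a b : ℝ) (hb : b ≠ 0) (F : ℝ → ℝ → ℝ) (φ : ℝ → ℝ → ℝ)
    (hφ : ContDiff ℝ 2 (Function.uncurry φ))
    (hpos : ∀ x τ : ℝ, 0 < φ x τ)
    (heq : ∀ x τ : ℝ, deriv (φ x) τ = deriv (deriv (fun y => φ y τ)) x + F x (φ x τ))
    (u : ℝ → ℝ → ℝ)
    (hu : ∀ x t : ℝ, u x t = -b^2 * Real.log (φ x (-b^2 * t / 2)) - a * x)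
    (f : ℝ → ℝ → ℝ)
    (hf : ∀ x w : ℝ, f x w = (b^4 / 2) * Real.exp ((a * x + w) / b^2)
        * F x (Real.exp (-(a * x + w) / b^2)) + a^2 / 2) :
    ∀ x t : ℝ, deriv (u x) t =
      a * deriv (fun y => u y t) x + (1/2) * (deriv (fun y => u y t) x)^2
        - (1/2) * b^2 * deriv (deriv (fun y => u y t)) x + f x (u x t) := by
  intro x t
  have hb2 : b ^ 2 ≠ 0 := pow_ne_zero 2 hb
  set τ : ℝ := -b ^ 2 * t / 2 with hτ
  have hne : ∀ y s : ℝ, φ y s ≠ 0 := fun y s => (hpos y s).ne'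
  have hX : ContDiff ℝ 2 (fun y => φ y τ) :=
    hφ.comp (contDiff_id.prodMk contDiff_const)
  have hT : ContDiff ℝ 2 (φ x) :=
    hφ.comp (contDiff_const.prodMk contDiff_id)
  have hXd : ∀ y, HasDerivAt (fun y => φ y τ) (deriv (fun y => φ y τ) y) y :=
    fun y => (hX.differentiable (by norm_num) y).hasDerivAt
  have hXX : HasDerivAt (deriv (fun y => φ y τ)) (deriv (deriv (fun y => φ y τ)) x) x := by
    have h : ContDiff ℝ (1 + 1) (fun y => φ y τ) := by
      rw [one_add_one_eq_two]
      exact hX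
    exact ((contDiff_succ_iff_deriv.mp h).2.2.differentiable (by norm_num) x).hasDerivAt
  have hTd : HasDerivAt (φ x) (deriv (φ x) τ) τ :=
    (hT.differentiable (by norm_num) τ).hasDerivAt
  have hut : HasDerivAt (u x) (-b ^ 2 * (deriv (φ x) τ * (-b ^ 2 / 2) / φ x τ)) t := by
    have hlin : HasDerivAt (fun s : ℝ => -b ^ 2 * s / 2) (-b ^ 2 / 2) t := by
      simpa using ((hasDerivAt_id t).const_mul (-b ^ 2)).div_const 2
    have hcomp : HasDerivAt (fun s => φ x (-b ^ 2 * s / 2)) (deriv (φ x) τ * (-b ^ 2 / 2)) t :=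
      HasDerivAt.comp t hTd hlin
    rw [show u x = fun s => -b ^ 2 * Real.log (φ x (-b ^ 2 * s / 2)) - a * x from funext (hu x)]
    exact ((hcomp.log (hne _ _)).const_mul (-b ^ 2)).sub_const (a * x)
  have hux : deriv (fun y => u y t) = fun y => -b ^ 2 * (deriv (fun y => φ y τ) y / φ y τ) - a := by
    funext y
    rw [show (fun y => u y t) = fun y => -b ^ 2 * Real.log (φ y τ) - a * y from
      funext fun y => hu y t]
    have hlin : HasDerivAt (fun y : ℝ => a * y) a y := by
      simpa using (hasDerivAt_id y).const_mul a
    exact ((((hXd y).log (hne _ _)).const_mul (-b ^ 2)).sub hlin).deriv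
  have huxx := (((hXX.div (hXd x) (hne x τ)).const_mul (-b ^ 2)).sub_const a).deriv
  have hexp : (a * x + u x t) / b ^ 2 = -Real.log (φ x τ) := by
    rw [hu x t, ← hτ]
    field_simp
    ring
  have hsource : f x (u x t) = b ^ 4 / 2 * (φ x τ)⁻¹ * F x (φ x τ) + a ^ 2 / 2 := by
    rw [hf, neg_div, hexp, neg_neg, Real.exp_neg, Real.exp_log (hpos x τ)]
  rw [hut.deriv, hux, hsource, heq x τ]
  erw [huxx]
  have := hne x τ
  field_simp
  ring
end

section
/- Let a, b ∈ ℝ with b ≠ 0, and let g : ℝ → ℝ. Suppose u : ℝ × ℝ → ℝ is twice continuously differentiable and satisfies u_t(x,t) = a·u_x(x,t) + (1/2)·u_x(x,t)² − (1/2)·b²·u_xx(x,t) + (1/2)·(exp((a·x + u(x,t))/b²)·g(x) + a²) for all (x,t) ∈ ℝ². Define φ(x,τ) = exp(−(a·x + u(x, −2τ/b²))/b²). Then φ satisfies the linear inhomogeneous heat equation φ_τ(x,τ) = φ_xx(x,τ) + g(x)/b⁴ for all (x,τ) ∈ ℝ². In particular, when f has the form f(x,u) = (1/2)·(exp((a·x+u)/b²)·g(x)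 + a²) the generalized Heath equation is linearizable by a point transformation. -/
/-- When f(x,u) = (1/2)(exp((ax+u)/b²)·g(x) + a²), the transformation
φ = exp(−(ax+u)/b²), τ = −b²t/2 linearizes the generalized Heath equation into the
linear inhomogeneous heat equation φ_τ = φ_xx + g(x)/b⁴. -/
theorem heath_linearizable_case
    (a b : ℝ) (hb : b ≠ 0) (g : ℝ → ℝ) (u : ℝ → ℝ → ℝ)
    (hu : ContDiff ℝ 2 (Function.uncurry u))
    (heq : ∀ x t : ℝ, deriv (u x) t =
      a * deriv (fun y => u y t) x + (1/2) * (deriv (fun y => u y t) x)^2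
        - (1/2) * b^2 * deriv (deriv (fun y => u y t)) x
        + (1/2) * (Real.exp ((a * x + u x t) / b^2) * g x + a^2))
    (φ : ℝ → ℝ → ℝ)
    (hφ : ∀ x τ : ℝ, φ x τ = Real.exp (-(a * x + u x (-2 * τ / b^2)) / b^2)) :
    ∀ x τ : ℝ, deriv (φ x) τ = deriv (deriv (fun y => φ y τ)) x + g x / b^4 := by
  intro x τ
  obtain rfl : φ = fun x τ => Real.exp (-(a * x + u x (-2 * τ / b ^ 2)) / b ^ 2) := by
    funext x τ
    exact hφ x τ
  set t : ℝ := -2 * τ / b ^ 2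
  have hut : HasDerivAt (u x) (deriv (u x) t) t := by
    have h : ContDiff ℝ 2 (u x) := hu.comp (contDiff_const.prodMk contDiff_id)
    exact (h.differentiable (by norm_num) t).hasDerivAt
  have hslice : ContDiff ℝ 2 (fun y => u y t) := hu.comp (contDiff_id.prodMk contDiff_const)
  have hux (y : ℝ) : HasDerivAt (fun y => u y t) (deriv (fun y => u y t) y) y :=
    (hslice.differentiable (by norm_num) y).hasDerivAt
  have huxx : HasDerivAt (deriv (fun y => u y t)) (deriv (deriv (fun y => u y t)) x) x := by
    have h : ContDiff ℝ 1 (deriv (fun y => u y t)) :=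
      (contDiff_succ_iff_deriv (n := 1).1 (by simpa [one_add_one_eq_two] using hslice)).2.2
    exact (h.differentiable (by norm_num) x).hasDerivAt
  have hφx (y : ℝ) : HasDerivAt (fun y => Real.exp (-(a * y + u y t) / b ^ 2))
      (Real.exp (-(a * y + u y t) / b ^ 2) * (-(a * 1 + deriv (fun y => u y t) y) / b ^ 2)) y :=
    ((((hasDerivAt_id y).const_mul a).add (hux y)).neg.div_const (b ^ 2)).exp
  have hφxx := (hφx x).mul ((huxx.const_add (a * 1)).neg.div_const (b ^ 2))
  have hφt : HasDerivAt (fun τ => Real.exp (-(a * x + u x (-2 * τ / b ^ 2)) / b ^ 2))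
      (Real.exp (-(a * x + u x t) / b ^ 2) *
        (-(deriv (u x) t * (-2 * 1 / b ^ 2)) / b ^ 2)) τ := by
    have hlin : HasDerivAt (fun τ : ℝ => -2 * τ / b ^ 2) (-2 * 1 / b ^ 2) τ :=
      ((hasDerivAt_id τ).const_mul (-2)).div_const (b ^ 2)
    exact (((hut.comp τ hlin).const_add (a * x)).neg.div_const (b ^ 2)).exp
  have hderiv : deriv (fun y => Real.exp (-(a * y + u y t) / b ^ 2)) = fun y =>
      Real.exp (-(a * y + u y t) / b ^ 2) * (-(a * 1 + deriv (fun y => u y t) y) / b ^ 2) :=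
    funext fun y => (hφx y).deriv
  have hexp : Real.exp (-(a * x + u x t) / b ^ 2) * Real.exp ((a * x + u x t) / b ^ 2) = 1 := by
    rw [← Real.exp_add, neg_div, neg_add_cancel, Real.exp_zero]
  have hxx := hφxx.deriv
  change deriv (fun y => Real.exp (-(a * y + u y t) / b ^ 2) *
    (-(a * 1 + deriv (fun y => u y t) y) / b ^ 2)) x = _ at hxx
  change deriv (fun τ => Real.exp (-(a * x + u x (-2 * τ / b ^ 2)) / b ^ 2)) τ =
    deriv (deriv (fun y => Real.exp (-(a * y + u y t) / b ^ 2))) x + g x / b ^ 4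
  rw [hφt.deriv, hderiv, hxx, heq x t]
  simp only [Pi.neg_apply]
  generalize Real.exp (-(a * x + u x t) / b ^ 2) = E at hexp ⊢
  generalize Real.exp ((a * x + u x t) / b ^ 2) = F at hexp ⊢
  field_simp
  linear_combination g x * hexp
end

section
/- Let δ₀, δ₁, δ₃, δ₄ ∈ ℝ with δ₁ ≠ 0 and δ₄ ≠ 0, let 𝓕 : ℝ → ℝ be twice continuously differentiable, and let F : ℝ × ℝ → ℝ. Suppose φ : ℝ × ℝ → ℝ is twice continuously differentiable and satisfies φ_τ(x,τ) = φ_xx(x,τ) + F(x, φ(x,τ)) for all (x,τ) ∈ ℝ². Define φ̃(x̃,τ̃) = δ₁·φ((x̃−δ₃)/δ₄, (τ̃−δ₀)/δ₄²) + 𝓕((x̃−δ₃)/δ₄), and define G(x̃,ṽ) = (δ₁/δ₄²)·F((x̃−δ₃)/δ₄, (ṽ − 𝓕((x̃−δ₃)/δ₄))/δ₁) − (1/δ₄²)·𝓕''((x̃−δ₃)/δ₄). Then φ̃ satisfies φ̃_τ̃(x̃,τ̃) = φ̃_x̃x̃(x̃,τ̃) + G(x̃, φ̃(x̃,τ̃))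 for all (x̃,τ̃) ∈ ℝ². Thus the point transformation x̃ = δ₄·x + δ₃, τ̃ = δ₄²·τ + δ₀, φ̃ = δ₁·φ + 𝓕(x) maps the class of heat equations with nonlinear source into itself. -/
/-- The chain rule for an affine change of variables, with no differentiability hypothesis. -/
lemma deriv_comp_sub_div (f : ℝ → ℝ) (b c x : ℝ) :
    deriv (fun y => f ((y - b) / c)) x = deriv f ((x - b) / c) / c := by
  have h := deriv_comp_mul_left c⁻¹ f (x - b)
  rw [← deriv_comp_sub_const (f := fun y => f (c⁻¹ * y))] at h
  simpa only [div_eq_inv_mul, smul_eq_mul] using h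


/-- The point transformation x̃ = δ₄x + δ₃, τ̃ = δ₄²τ + δ₀, φ̃ = δ₁φ + 𝓕(x)
maps the class of heat equations with nonlinear source into itself. -/
theorem equivalence_transformation_heat_source
    (d0 d1 d3 d4 : ℝ) (hd1 : d1 ≠ 0) (hd4 : d4 ≠ 0)
    (Fc : ℝ → ℝ) (hFc : ContDiff ℝ 2 Fc)
    (F : ℝ → ℝ → ℝ) (φ : ℝ → ℝ → ℝ)
    (hφ : ContDiff ℝ 2 (Function.uncurry φ))
    (heq : ∀ x τ : ℝ, deriv (φ x) τ = deriv (deriv (fun y => φ y τ)) x + F x (φ x τ))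
    (ψ : ℝ → ℝ → ℝ)
    (hψ : ∀ x τ : ℝ, ψ x τ =
      d1 * φ ((x - d3) / d4) ((τ - d0) / d4^2) + Fc ((x - d3) / d4))
    (G : ℝ → ℝ → ℝ)
    (hG : ∀ x v : ℝ, G x v =
      (d1 / d4^2) * F ((x - d3) / d4) ((v - Fc ((x - d3) / d4)) / d1)
        - (1 / d4^2) * deriv (deriv Fc) ((x - d3) / d4)) :
    ∀ x τ : ℝ, deriv (ψ x) τ = deriv (deriv (fun y => ψ y τ)) x + G x (ψ x τ) := by
  intro x τ
  set X := (x - d3) / d4 with hX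
  set T := (τ - d0) / d4 ^ 2 with hT
  have hslice : ContDiff ℝ 2 (fun y => φ y T) :=
    hφ.comp (contDiff_id.prodMk contDiff_const)
  have time_deriv : deriv (ψ x) τ = d1 / d4 ^ 2 * deriv (φ X) T := by
    rw [funext (hψ x), deriv_add_const, deriv_const_mul_field, deriv_comp_sub_div (φ X)]
    ring
  have slice_deriv : deriv (fun y => d1 * φ y T + Fc y) =
      fun y => d1 * deriv (fun z => φ z T) y + deriv Fc y := by
    funext y
    rw [deriv_fun_add ((hslice.differentiable two_ne_zero y).const_mul d1)
      (hFc.differentiable two_ne_zero y), deriv_const_mul_field]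
  have slice_deriv_deriv : deriv (deriv (fun y => d1 * φ y T + Fc y)) X =
      d1 * deriv (deriv (fun z => φ z T)) X + deriv (deriv Fc) X := by
    rw [slice_deriv, deriv_fun_add ((hslice.differentiable_deriv_two X).const_mul d1)
      (hFc.differentiable_deriv_two X), deriv_const_mul_field]
  have space_deriv : deriv (fun y => ψ y τ) =
      fun y => deriv (fun z => d1 * φ z T + Fc z) ((y - d3) / d4) / d4 := by
    funext y
    rw [funext fun z => hψ z τ, ← deriv_comp_sub_div (fun z => d1 * φ z T + Fc z)]
  have source : (ψ x τ - Fc X) / d1 = φ X T := by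
    rw [hψ, add_sub_cancel_right, mul_div_cancel_left₀ _ hd1]
  rw [time_deriv, space_deriv, deriv_div_const,
    deriv_comp_sub_div (deriv fun z => d1 * φ z T + Fc z), ← hX, slice_deriv_deriv,
    hG, ← hX, source, heq]
  field_simp
  ring
end

section
/- Let A, B ∈ ℝ with A ≠ 0, and let s ∈ ℝ. Suppose φ : ℝ × ℝ → (0,∞) is twice continuously differentiable and satisfies φ_τ(x,τ) = φ_xx(x,τ) + φ(x,τ)·(A·log φ(x,τ) + B·x) for all (x,τ) ∈ ℝ². Define φ̃(x,τ) = φ(x,τ)·exp(s·e^{A·τ}). Then φ̃ > 0 and φ̃ satisfies φ̃_τ(x,τ) = φ̃_xx(x,τ) + φ̃(x,τ)·(A·log φ̃(x,τ) + B·x) for all (x,τ) ∈ ℝ². (This is the finite form of the symmetry e^{Aτ}φ∂_φ admitted by the heat equation with source F̂(x,φ) = φ·(A·log|φ| + B·x).) -/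
/-- The symmetry e^{Aτ}φ∂_φ of the heat equation with source
φ(A·log φ + Bx): if φ > 0 solves it, so does φ̃ = φ·exp(s·e^{Aτ}). -/
theorem exp_scaling_symmetry_log_source
    (A B : ℝ) (hA : A ≠ 0) (s : ℝ) (φ : ℝ → ℝ → ℝ)
    (hφ : ContDiff ℝ 2 (Function.uncurry φ))
    (hpos : ∀ x τ : ℝ, 0 < φ x τ)
    (heq : ∀ x τ : ℝ, deriv (φ x) τ = deriv (deriv (fun y => φ y τ)) x
        + φ x τ * (A * Real.log (φ x τ) + B * x))
    (ψ : ℝ → ℝ → ℝ)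
    (hψ : ∀ x τ : ℝ, ψ x τ = φ x τ * Real.exp (s * Real.exp (A * τ))) :
    (∀ x τ : ℝ, 0 < ψ x τ) ∧
    (∀ x τ : ℝ, deriv (ψ x) τ = deriv (deriv (fun y => ψ y τ)) x
        + ψ x τ * (A * Real.log (ψ x τ) + B * x)) := by
  obtain rfl : ψ = fun x τ => φ x τ * Real.exp (s * Real.exp (A * τ)) :=
    funext fun x => funext fun τ => hψ x τ
  refine ⟨fun x τ => mul_pos (hpos x τ) (Real.exp_pos _), fun x τ => ?_⟩
  have hdiff : DifferentiableAt ℝ (φ x) τ := by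
    have h : Differentiable ℝ fun t => Function.uncurry φ (x, t) :=
      (hφ.differentiable two_ne_zero).comp (by fun_prop)
    exact h τ
  have hinner : HasDerivAt (fun t => s * Real.exp (A * t)) (s * (Real.exp (A * τ) * A)) τ := by
    simpa using (((hasDerivAt_id τ).const_mul A).exp).const_mul s
  have hτ := (hdiff.hasDerivAt.fun_mul hinner.exp).deriv
  have hxx : deriv (deriv fun y => φ y τ * Real.exp (s * Real.exp (A * τ))) x
      = deriv (deriv fun y => φ y τ) x * Real.exp (s * Real.exp (A * τ)) := by
    simp only [deriv_mul_const_field']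
  rw [hτ, hxx, heq, Real.log_mul (hpos x τ).ne' (Real.exp_pos _).ne', Real.log_exp]
  ring
end

section
/- Let A, B ∈ ℝ with A ≠ 0, and let s ∈ ℝ. Suppose φ : ℝ × ℝ → (0,∞) is twice continuously differentiable and satisfies φ_τ(x,τ) = φ_xx(x,τ) + φ(x,τ)·(A·log φ(x,τ) + B·x) for all (x,τ) ∈ ℝ². Define φ̃(x,τ) = e^{−B·s}·φ(x − A·s, τ). Then φ̃ > 0 and φ̃ satisfies φ̃_τ(x,τ) = φ̃_xx(x,τ) + φ̃(x,τ)·(A·log φ̃(x,τ) + B·x) for all (x,τ) ∈ ℝ². (This is the finite form of the symmetry A∂_x − Bφ∂_φ admitted by the heat equation with source F̂(x,φ) = φ·(A·log|φ| + B·x).) -/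
/-- The symmetry A∂_x − Bφ∂_φ of the heat equation with source
φ(A·log φ + Bx): if φ > 0 solves it, so does φ̃(x,τ) = e^{−Bs}·φ(x − As, τ). -/
theorem translation_symmetry_log_source
    (A B : ℝ) (hA : A ≠ 0) (s : ℝ) (φ : ℝ → ℝ → ℝ)
    (hφ : ContDiff ℝ 2 (Function.uncurry φ))
    (hpos : ∀ x τ : ℝ, 0 < φ x τ)
    (heq : ∀ x τ : ℝ, deriv (φ x) τ = deriv (deriv (fun y => φ y τ)) x
        + φ x τ * (A * Real.log (φ x τ) + B * x))
    (ψ : ℝ → ℝ → ℝ)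
    (hψ : ∀ x τ : ℝ, ψ x τ = Real.exp (-B * s) * φ (x - A * s) τ) :
    (∀ x τ : ℝ, 0 < ψ x τ) ∧
    (∀ x τ : ℝ, deriv (ψ x) τ = deriv (deriv (fun y => ψ y τ)) x
        + ψ x τ * (A * Real.log (ψ x τ) + B * x)) := by
  refine ⟨fun x τ => by rw [hψ]; exact mul_pos (Real.exp_pos _) (hpos _ _), fun x τ => ?_⟩
  have hτ : deriv (ψ x) τ = Real.exp (-B * s) * deriv (φ (x - A * s)) τ := by
    rw [funext (hψ x), deriv_const_mul_field]
  have hx : deriv (fun y => ψ y τ) =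
      fun y => Real.exp (-B * s) * deriv (fun z => φ z τ) (y - A * s) := by
    funext y
    simp only [hψ]
    rw [deriv_const_mul_field, deriv_comp_sub_const (fun z => φ z τ)]
  have hxx : deriv (deriv (fun y => ψ y τ)) x =
      Real.exp (-B * s) * deriv (deriv (fun z => φ z τ)) (x - A * s) := by
    rw [hx, deriv_const_mul_field, deriv_comp_sub_const (deriv fun z => φ z τ)]
  rw [hτ, hxx, heq, hψ, Real.log_mul (Real.exp_ne_zero _) (hpos _ _).ne', Real.log_exp]
  ring
end

section
/- Let A, B ∈ ℝ with A ≠ 0, and let s ∈ ℝ. Suppose φ : ℝ × ℝ → (0,∞) is twice continuously differentiable and satisfies φ_τ(x,τ) = φ_xx(x,τ) + φ(x,τ)·(A·log φ(x,τ) + B·x) for all (x,τ) ∈ ℝ². Define φ̃(x,τ) = φ(x − 2·s·e^{A·τ}, τ)·exp(−s·A·e^{A·τ}·x + s²·A·e^{2A·τ} + 2·B·s·τ·e^{A·τ}). Then φ̃ > 0 and φ̃ satisfies φ̃_τ(x,τ) = φ̃_xx(x,τ) + φ̃(x,τ)·(A·log φ̃(x,τ) + B·x) for all (x,τ) ∈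 ℝ². (This is the finite form of the Galilean-type symmetry 2e^{Aτ}∂_x − e^{Aτ}(Ax − 2Bτ)φ∂_φ admitted by the heat equation with source F̂(x,φ) = φ·(A·log|φ| + B·x).) -/
/-- The total derivative along a curve of a differentiable function of two real variables, in terms
of its partial derivatives. -/
theorem hasDerivAt_comp_curve_of_differentiable {f : ℝ → ℝ → ℝ}
    (hf : Differentiable ℝ (Function.uncurry f)) {c : ℝ → ℝ} {c' t : ℝ} (hc : HasDerivAt c c' t) :
    HasDerivAt (fun r => f (c r) r)
      (c' * deriv (fun y => f y t) (c t) + deriv (f (c t)) t) t := by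
  have hL := (hf (c t, t)).hasFDerivAt
  set L := fderiv ℝ (Function.uncurry f) (c t, t)
  have h₁ : HasDerivAt (fun y => f y t) (L (1, 0)) (c t) :=
    HasFDerivAt.comp_hasDerivAt (f := fun y => (y, t)) (c t) hL
      ((hasDerivAt_id (c t)).prodMk (hasDerivAt_const (c t) t))
  have h₂ : HasDerivAt (f (c t)) (L (0, 1)) t :=
    HasFDerivAt.comp_hasDerivAt (f := fun r => (c t, r)) t hL
      ((hasDerivAt_const t (c t)).prodMk (hasDerivAt_id t))
  have h : HasDerivAt (fun r => f (c r) r) (L (c', 1)) t :=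
    HasFDerivAt.comp_hasDerivAt (f := fun r => (c r, r)) t hL (hc.prodMk (hasDerivAt_id t))
  have hsplit : L (c', 1) = c' * L (1, 0) + L (0, 1) := by
    rw [← smul_eq_mul, ← map_smul, ← map_add]
    simp
  rwa [h₁.deriv, h₂.deriv, ← hsplit]

/-- The second derivative of a translate of a `C²` function multiplied by the exponential of an
affine function. -/
theorem deriv_deriv_comp_sub_mul_exp {u : ℝ → ℝ} (hu : ContDiff ℝ 2 u) (a k m x : ℝ) :
    deriv (deriv fun y => u (y - a) * Real.exp (k * y + m)) x =
      (deriv (deriv u) (x - a) + 2 * k * deriv u (x - a) + k ^ 2 * u (x - a)) *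
        Real.exp (k * x + m) := by
  have hu' : Differentiable ℝ u := hu.differentiable (by norm_num)
  have hu'' : Differentiable ℝ (deriv u) :=
    (contDiff_succ_iff_deriv.1 (show ContDiff ℝ (1 + 1) u from hu)).2.2.differentiable
      (by norm_num)
  have hexp (y : ℝ) : HasDerivAt (fun y => Real.exp (k * y + m)) (Real.exp (k * y + m) * k) y := by
    simpa using (((hasDerivAt_id y).const_mul k).add_const m).exp
  have hfirst : (deriv fun y => u (y - a) * Real.exp (k * y + m)) =
      fun y => (deriv u (y - a) + k * u (y - a)) * Real.exp (k * y + m) := by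
    funext y
    refine (((hu' (y - a)).hasDerivAt.comp_sub_const y a).mul (hexp y)).deriv.trans ?_
    ring
  rw [hfirst]
  refine ((((hu'' (x - a)).hasDerivAt.comp_sub_const x a).add
    (((hu' (x - a)).hasDerivAt.comp_sub_const x a).const_mul k)).mul (hexp x)).deriv.trans ?_
  simp only [Pi.add_apply]
  ring

/-- The Galilean-type symmetry 2e^{Aτ}∂_x − e^{Aτ}(Ax − 2Bτ)φ∂_φ of the heat
equation with source φ(A·log φ + Bx): if φ > 0 solves it, so does
φ̃(x,τ) = φ(x − 2se^{Aτ}, τ)·exp(−sAe^{Aτ}x + s²Ae^{2Aτ} + 2Bsτe^{Aτ}). -/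
theorem galilean_symmetry_log_source
    (A B : ℝ) (hA : A ≠ 0) (s : ℝ) (φ : ℝ → ℝ → ℝ)
    (hφ : ContDiff ℝ 2 (Function.uncurry φ))
    (hpos : ∀ x τ : ℝ, 0 < φ x τ)
    (heq : ∀ x τ : ℝ, deriv (φ x) τ = deriv (deriv (fun y => φ y τ)) x
        + φ x τ * (A * Real.log (φ x τ) + B * x))
    (ψ : ℝ → ℝ → ℝ)
    (hψ : ∀ x τ : ℝ, ψ x τ = φ (x - 2 * s * Real.exp (A * τ)) τ
        * Real.exp (-s * A * Real.exp (A * τ) * x + s^2 * A * Real.exp (2 * A * τ)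
            + 2 * B * s * τ * Real.exp (A * τ))) :
    (∀ x τ : ℝ, 0 < ψ x τ) ∧
    (∀ x τ : ℝ, deriv (ψ x) τ = deriv (deriv (fun y => ψ y τ)) x
        + ψ x τ * (A * Real.log (ψ x τ) + B * x)) := by
  refine ⟨fun x τ => hψ x τ ▸ mul_pos (hpos _ _) (Real.exp_pos _), fun x τ => ?_⟩
  have hE : HasDerivAt (fun t => Real.exp (A * t)) (Real.exp (A * τ) * A) τ := by
    simpa using ((hasDerivAt_id τ).const_mul A).exp
  have hsq (t : ℝ) : Real.exp (2 * A * t) = Real.exp (A * t) ^ 2 := by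
    rw [← Real.exp_nat_mul]
    push_cast
    ring_nf
  have hlog : Real.log (ψ x τ) = Real.log (φ (x - 2 * s * Real.exp (A * τ)) τ) +
      (-s * A * Real.exp (A * τ) * x + s ^ 2 * A * Real.exp (A * τ) ^ 2 +
        2 * B * s * τ * Real.exp (A * τ)) := by
    rw [hψ, Real.log_mul (hpos _ _).ne' (Real.exp_ne_zero _), Real.log_exp, hsq]
  have hxx := deriv_deriv_comp_sub_mul_exp (u := fun y => φ y τ)
    (hφ.comp (contDiff_id.prodMk contDiff_const))
    (2 * s * Real.exp (A * τ)) (-s * A * Real.exp (A * τ))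
    (s ^ 2 * A * Real.exp (A * τ) ^ 2 + 2 * B * s * τ * Real.exp (A * τ)) x
  have hτ := (hasDerivAt_comp_curve_of_differentiable (hφ.differentiable (by norm_num))
    ((hE.const_mul (2 * s)).const_sub x)).mul
    ((((hE.const_mul (-s * A)).mul_const x).add ((hE.pow 2).const_mul (s ^ 2 * A))).add
      (((hasDerivAt_id τ).const_mul (2 * B * s)).mul hE)).exp
  have hψτ : ψ x = fun t => φ (x - 2 * s * Real.exp (A * t)) t *
      Real.exp (-s * A * Real.exp (A * t) * x + s ^ 2 * A * Real.exp (A * t) ^ 2 +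
        2 * B * s * t * Real.exp (A * t)) := by
    funext t
    rw [hψ, hsq]
  have hψx : (fun y => ψ y τ) = fun y => φ (y - 2 * s * Real.exp (A * τ)) τ *
      Real.exp (-s * A * Real.exp (A * τ) * y + (s ^ 2 * A * Real.exp (A * τ) ^ 2 +
        2 * B * s * τ * Real.exp (A * τ))) := by
    funext y
    rw [hψ, hsq, add_assoc]
  rw [hlog, hψx, hxx, hψτ]
  refine hτ.deriv.trans ?_
  rw [heq]
  simp only [Pi.add_apply, Pi.mul_apply, Pi.pow_apply, id_eq, ← add_assoc]
  push_cast
  ring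
end

section
/- Let A, B, Γ, Δ ∈ ℝ with A ≠ 0, let F : ℝ → ℝ, let s ∈ ℝ, and let D ⊆ ℝ² be an open set. Suppose φ : D → ℝ is twice continuously differentiable, (Δ + x·(Γ·x + B))·φ(x,τ) > 0 for all (x,τ) ∈ D, and φ satisfies φ_τ(x,τ) = φ_xx(x,τ) − (F(x) + A·log((Δ + x·(Γ·x + B))·φ(x,τ)))·φ(x,τ) on D. Define φ̃(x,τ) = φ(x,τ)·exp(s·e^{−A·τ}). Then (Δ + x·(Γ·x + B))·φ̃(x,τ) > 0 on D and φ̃ satisfies φ̃_τ(x,τ) = φ̃_xx(x,τ) − (F(x) + A·log((Δ + x·(Γ·x + B))·φ̃(x,τ)))·φ̃(x,τ) on D. (This is the finite form of the symmetry e^{−Aτ}φ∂_φ admitted by the heat equation with source F̂(x,φ) = −(F(x) + A·log((Δ + x(Γx + B))·φ))·φ.) -/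
/-- The symmetry e^{−Aτ}φ∂_φ of the heat equation with source
−(F(x) + A·log((Δ + x(Γx + B))·φ))·φ on an open set D: if φ solves it on D with
(Δ + x(Γx + B))·φ > 0, then so does φ̃ = φ·exp(s·e^{−Aτ}). -/
theorem exp_symmetry_log_argument_source
    (A B Γ Δ : ℝ) (hA : A ≠ 0) (F : ℝ → ℝ) (s : ℝ)
    (D : Set (ℝ × ℝ)) (hD : IsOpen D) (φ : ℝ → ℝ → ℝ)
    (hφ : ContDiffOn ℝ 2 (Function.uncurry φ) D)
    (hpos : ∀ x τ : ℝ, (x, τ) ∈ D → 0 < (Δ + x * (Γ * x + B)) * φ x τ)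
    (heq : ∀ x τ : ℝ, (x, τ) ∈ D → deriv (φ x) τ = deriv (deriv (fun y => φ y τ)) x
        - (F x + A * Real.log ((Δ + x * (Γ * x + B)) * φ x τ)) * φ x τ)
    (ψ : ℝ → ℝ → ℝ)
    (hψ : ∀ x τ : ℝ, ψ x τ = φ x τ * Real.exp (s * Real.exp (-A * τ))) :
    (∀ x τ : ℝ, (x, τ) ∈ D → 0 < (Δ + x * (Γ * x + B)) * ψ x τ) ∧
    (∀ x τ : ℝ, (x, τ) ∈ D → deriv (ψ x) τ = deriv (deriv (fun y => ψ y τ)) x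
        - (F x + A * Real.log ((Δ + x * (Γ * x + B)) * ψ x τ)) * ψ x τ) := by
  obtain rfl : ψ = fun x τ => φ x τ * Real.exp (s * Real.exp (-A * τ)) := by
    funext x τ
    exact hψ x τ
  refine ⟨fun x τ h => ?_, fun x τ h => ?_⟩
  · rw [← mul_assoc]
    exact mul_pos (hpos x τ h) (Real.exp_pos _)
  · have hdiff : DifferentiableAt ℝ (φ x) τ := by
      have hu : DifferentiableAt ℝ (Function.uncurry φ) (x, τ) :=
        (hφ.contDiffAt (hD.mem_nhds h)).differentiableAt (by norm_num)
      exact DifferentiableAt.comp (f := fun t : ℝ => (x, t)) τ hu (by fun_prop)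
    have hexp : HasDerivAt (fun t => Real.exp (s * Real.exp (-A * t)))
        (Real.exp (s * Real.exp (-A * τ)) * (s * (Real.exp (-A * τ) * (-A * 1)))) τ :=
      ((((hasDerivAt_id τ).const_mul (-A)).exp).const_mul s).exp
    have hτ := (hdiff.hasDerivAt.mul hexp).deriv
    have hx : deriv (fun y => φ y τ * Real.exp (s * Real.exp (-A * τ))) =
        fun y => deriv (fun y => φ y τ) y * Real.exp (s * Real.exp (-A * τ)) := by
      funext y
      exact deriv_mul_const_field _
    have hlog : Real.log ((Δ + x * (Γ * x + B)) * (φ x τ * Real.exp (s * Real.exp (-A * τ)))) =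
        Real.log ((Δ + x * (Γ * x + B)) * φ x τ) + s * Real.exp (-A * τ) := by
      rw [← mul_assoc, Real.log_mul (hpos x τ h).ne' (Real.exp_pos _).ne', Real.log_exp]
    refine hτ.trans ?_
    rw [hx, deriv_mul_const_field, hlog, heq x τ h]
    ring
end

section
/- Let A, B ∈ ℝ with A ∉ {0, −1, −2}, and let s ∈ ℝ. Suppose φ : ℝ × ℝ → (0,∞) is twice continuously differentiable and satisfies φ_τ(x,τ) = φ_xx(x,τ) − e^{−(A+1)·B·x}·φ(x,τ)^{−A} − B²·φ(x,τ) for all (x,τ) ∈ ℝ². Define φ̃(x,τ) = e^{−B·s}·φ(x − s, τ). Then φ̃ > 0 and φ̃ satisfies φ̃_τ(x,τ) = φ̃_xx(x,τ) − e^{−(A+1)·B·x}·φ̃(x,τ)^{−A} − B²·φ̃(x,τ) for all (x,τ) ∈ ℝ². (This is the finite form of the translation-type symmetry ∂_x − Bφ∂_φ admitted by the heat equation with source F̂(x,φ) = −e^{−(A+1)Bx}|φ|^{−A} − B²φ.) -/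
/-- The translation-type symmetry ∂_x − Bφ∂_φ of the heat equation with source
−e^{−(A+1)Bx}·φ^{−A} − B²·φ: if φ > 0 solves it, so does φ̃(x,τ) = e^{−Bs}·φ(x − s, τ). -/
theorem translation_symmetry_power_source
    (A B : ℝ) (hA0 : A ≠ 0) (hA1 : A ≠ -1) (hA2 : A ≠ -2) (s : ℝ)
    (φ : ℝ → ℝ → ℝ)
    (hφ : ContDiff ℝ 2 (Function.uncurry φ))
    (hpos : ∀ x τ : ℝ, 0 < φ x τ)
    (heq : ∀ x τ : ℝ, deriv (φ x) τ = deriv (deriv (fun y => φ y τ)) x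
        - Real.exp (-(A + 1) * B * x) * (φ x τ) ^ (-A : ℝ) - B^2 * φ x τ)
    (ψ : ℝ → ℝ → ℝ)
    (hψ : ∀ x τ : ℝ, ψ x τ = Real.exp (-B * s) * φ (x - s) τ) :
    (∀ x τ : ℝ, 0 < ψ x τ) ∧
    (∀ x τ : ℝ, deriv (ψ x) τ = deriv (deriv (fun y => ψ y τ)) x
        - Real.exp (-(A + 1) * B * x) * (ψ x τ) ^ (-A : ℝ) - B^2 * ψ x τ) := by
  have hψx : ∀ x, ψ x = fun τ => Real.exp (-B * s) * φ (x - s) τ := fun x => funext (hψ x)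
  refine ⟨fun x τ => ?_, fun x τ => ?_⟩
  · rw [hψ]
    exact mul_pos (Real.exp_pos _) (hpos _ _)
  have hτ : deriv (ψ x) τ = Real.exp (-B * s) * deriv (φ (x - s)) τ := by
    rw [hψx, deriv_const_mul_field]
  have hx : deriv (fun y => ψ y τ) =
      fun y => Real.exp (-B * s) * deriv (fun z => φ z τ) (y - s) := by
    funext y
    simp only [hψ]
    rw [deriv_const_mul_field, deriv_comp_sub_const (f := fun z => φ z τ)]
  have hxx : deriv (deriv (fun y => ψ y τ)) x =
      Real.exp (-B * s) * deriv (deriv (fun z => φ z τ)) (x - s) := by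
    rw [hx, deriv_const_mul_field, deriv_comp_sub_const (f := deriv (fun z => φ z τ))]
  have hpow : (ψ x τ) ^ (-A : ℝ) = Real.exp (A * B * s) * (φ (x - s) τ) ^ (-A : ℝ) := by
    rw [hψ, Real.mul_rpow (Real.exp_pos _).le (hpos _ _).le, ← Real.exp_mul]
    ring_nf
  have hexp : Real.exp (-B * s) * Real.exp (-(A + 1) * B * (x - s)) =
      Real.exp (-(A + 1) * B * x) * Real.exp (A * B * s) := by
    rw [← Real.exp_add, ← Real.exp_add]
    ring_nf
  rw [hτ, hxx, hpow, hψ, heq]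
  linear_combination (-(φ (x - s) τ) ^ (-A : ℝ)) * hexp
end

section
/- Let a, b, T ∈ ℝ with b ≠ 0, and let D = {(x,t) ∈ ℝ² : 2·e^{b²t/2} − e^{b²T/2} > 0}. Define u : D → ℝ by u(x,t) = e^{−3b²t/2}/(96·b²·(2·e^{b²t/2} − e^{b²T/2})) · ( 3·b⁶·(e^{2b²T} − 2·e^{b²(t+3T)/2})·T − 96·a²·(e^{2b²T} − e^{b²(t+3T)/2}) − 96·b²·(e^{2b²T} − 2·e^{b²(t+3T)/2} + 2·a·e^{2b²t}·x − a·e^{b²(t+T)}·x − a·e^{b²(3t+T)/2}·x) + 4·b⁴·(2·e^{2b²T} + 3·e^{b²(t+T)} − 7·e^{b²(t+3T)/2} + 4·e^{2b²t}·(3x² − 2) − 2·e^{b²(3t+T)/2}·(6x² − 5)) − 6·b⁴·(e^{2b²T} − 2·e^{b²(t+3T)/2})·log(2·e^{b²t/2} − e^{b²T/2}) ). Then u satisfies the PDE u_t(x,t) = a·u_x(x,t) + (1/2)·u_x(x,t)² − (1/2)·b²·u_xx(x,t) + a²/2 + (1/2)·b⁴·(x²/2 − 3·(a·x + u(x,t))/b²)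 for all (x,t) ∈ D. -/
/-- The similarity solution as a function of `x`, `p = exp (b² t / 2)` and `l = log (2 p - q)`,
where `q = exp (b² T / 2)`. -/
noncomputable def similarityProfile (a b T q x p l : ℝ) : ℝ :=
  (3 * b^6 * (q^4 - 2 * (p * q^3)) * T - 96 * a^2 * (q^4 - p * q^3)
    - 96 * b^2 * (q^4 - 2 * (p * q^3) + 2 * a * p^4 * x - a * (p^2 * q^2) * x
        - a * (p^3 * q) * x)
    + 4 * b^4 * (2 * q^4 + 3 * (p^2 * q^2) - 7 * (p * q^3) + 4 * p^4 * (3 * x^2 - 2)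
        - 2 * (p^3 * q) * (6 * x^2 - 5))
    - 6 * b^4 * (q^4 - 2 * (p * q^3)) * l) / (p^3 * (96 * b^2 * (2 * p - q)))

/-- The derivative of `similarityProfile` in `x`. -/
noncomputable def similarityProfileDx (a b q x p : ℝ) : ℝ :=
  (-96 * b^2 * (2 * a * p^4 - a * (p^2 * q^2) - a * (p^3 * q))
    + 4 * b^4 * (24 * p^4 * x - 24 * (p^3 * q) * x)) / (p^3 * (96 * b^2 * (2 * p - q)))

lemma hasDerivAt_similarityProfile_x (a b T q x p l : ℝ) :
    HasDerivAt (fun y => similarityProfile a b T q y p l) (similarityProfileDx a b q x p) x := by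
  unfold similarityProfile similarityProfileDx
  have h1 := hasDerivAt_id' x
  have h2 := hasDerivAt_pow 2 x
  refine HasDerivAt.div_const ?_ _
  refine HasDerivAt.congr_deriv (((((h1.const_mul (2 * a * p^4)).const_add (q^4 - 2 * (p * q^3))).sub
      (h1.const_mul (a * (p^2 * q^2)))).sub (h1.const_mul (a * (p^3 * q)))).const_mul
      (96 * b^2) |>.const_sub (3 * b^6 * (q^4 - 2 * (p * q^3)) * T - 96 * a^2 * (q^4 - p * q^3))
    |>.add (((((h2.const_mul 3).sub_const 2).const_mul (4 * p^4)).const_add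
      (2 * q^4 + 3 * (p^2 * q^2) - 7 * (p * q^3))).sub
      (((h2.const_mul 6).sub_const 5).const_mul (2 * (p^3 * q))) |>.const_mul (4 * b^4))
    |>.sub_const (6 * b^4 * (q^4 - 2 * (p * q^3)) * l)) ?_
  push_cast
  ring

lemma hasDerivAt_similarityProfileDx (a b q x p : ℝ) :
    HasDerivAt (fun y => similarityProfileDx a b q y p)
      (4 * b^4 * (24 * p^4 - 24 * (p^3 * q)) / (p^3 * (96 * b^2 * (2 * p - q)))) x := by
  unfold similarityProfileDx
  have h1 := hasDerivAt_id' x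
  refine HasDerivAt.div_const ?_ _
  refine HasDerivAt.congr_deriv (((h1.const_mul (24 * p^4)).sub (h1.const_mul (24 * (p^3 * q)))).const_mul (4 * b^4)
    |>.const_add (-96 * b^2 * (2 * a * p^4 - a * (p^2 * q^2) - a * (p^3 * q)))) ?_
  ring

/-- The generalized Heath equation along curves `p(t)`, `l(t)` with `p' = b² p / 2` and
`l' = 2 p' / (2 p - q)`. -/
lemma hasDerivAt_similarityProfile_t {a b T q x t : ℝ} {p l : ℝ → ℝ} (hb : b ≠ 0)
    (hp0 : p t ≠ 0) (hd0 : 2 * p t - q ≠ 0) (hp : HasDerivAt p (b^2 / 2 * p t) t)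
    (hl : HasDerivAt l (b^2 * p t / (2 * p t - q)) t) :
    HasDerivAt (fun s => similarityProfile a b T q x (p s) (l s))
      (a * similarityProfileDx a b q x (p t) + (1/2) * (similarityProfileDx a b q x (p t))^2
        - (1/2) * b^2 * (4 * b^4 * (24 * p t^4 - 24 * (p t^3 * q)) /
            (p t^3 * (96 * b^2 * (2 * p t - q))))
        + a^2 / 2 + (1/2) * b^4 *
          (x^2 / 2 - 3 * (a * x + similarityProfile a b T q x (p t) (l t)) / b^2)) t := by
  unfold similarityProfile similarityProfileDx
  have e1 := hp.mul_const (q^3)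
  have e2 := (hp.pow 2).mul_const (q^2)
  have e3 := (hp.pow 3).mul_const q
  have e4 := hp.pow 4
  have k1 := (e1.const_mul 2).const_sub (q^4)
  have hden := (hp.pow 3).mul (((hp.const_mul 2).sub_const q).const_mul (96 * b^2))
  have hnum := ((k1.const_mul (3 * b^6)).mul_const T).sub ((e1.const_sub (q^4)).const_mul (96 * a^2))
    |>.sub ((((k1.add ((e4.const_mul (2 * a)).mul_const x)).sub
        ((e2.const_mul a).mul_const x)).sub ((e3.const_mul a).mul_const x)).const_mul (96 * b^2))
    |>.add ((((((e2.const_mul 3).const_add (2 * q^4)).sub (e1.const_mul 7)).add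
        ((e4.const_mul 4).mul_const (3 * x^2 - 2))).sub
        ((e3.const_mul 2).mul_const (6 * x^2 - 5))).const_mul (4 * b^4))
    |>.sub ((k1.const_mul (6 * b^4)).mul hl)
  have hne : p t^3 * (96 * b^2 * (2 * p t - q)) ≠ 0 := by positivity
  refine (hnum.div hden hne).congr_deriv ?_
  simp only [Pi.add_apply, Pi.sub_apply, Pi.mul_apply, Pi.pow_apply]
  generalize p t = P at *
  generalize l t = L at *
  push_cast
  field_simp
  ring

/-- The explicit similarity solution of the generalized Heath equation with
f(x,u) = a²/2 + (b⁴/2)(x²/2 − 3(ax+u)/b²), obtained from the algebra A₄¹ under the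
terminal condition, satisfies the PDE on D = {(x,t) : 2e^{b²t/2} − e^{b²T/2} > 0}. -/
theorem terminal_similarity_solution_solves_heath
    (a b T : ℝ) (hb : b ≠ 0) (u : ℝ → ℝ → ℝ)
    (hu : ∀ x t : ℝ, 0 < 2 * Real.exp (b^2 * t / 2) - Real.exp (b^2 * T / 2) →
      u x t = Real.exp (-3 * b^2 * t / 2) /
          (96 * b^2 * (2 * Real.exp (b^2 * t / 2) - Real.exp (b^2 * T / 2))) *
        (3 * b^6 * (Real.exp (2 * b^2 * T) - 2 * Real.exp (b^2 * (t + 3 * T) / 2)) * T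
          - 96 * a^2 * (Real.exp (2 * b^2 * T) - Real.exp (b^2 * (t + 3 * T) / 2))
          - 96 * b^2 * (Real.exp (2 * b^2 * T) - 2 * Real.exp (b^2 * (t + 3 * T) / 2)
              + 2 * a * Real.exp (2 * b^2 * t) * x - a * Real.exp (b^2 * (t + T)) * x
              - a * Real.exp (b^2 * (3 * t + T) / 2) * x)
          + 4 * b^4 * (2 * Real.exp (2 * b^2 * T) + 3 * Real.exp (b^2 * (t + T))
              - 7 * Real.exp (b^2 * (t + 3 * T) / 2)
              + 4 * Real.exp (2 * b^2 * t) * (3 * x^2 - 2)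
              - 2 * Real.exp (b^2 * (3 * t + T) / 2) * (6 * x^2 - 5))
          - 6 * b^4 * (Real.exp (2 * b^2 * T) - 2 * Real.exp (b^2 * (t + 3 * T) / 2))
              * Real.log (2 * Real.exp (b^2 * t / 2) - Real.exp (b^2 * T / 2)))) :
    ∀ x t : ℝ, 0 < 2 * Real.exp (b^2 * t / 2) - Real.exp (b^2 * T / 2) →
      deriv (u x) t =
        a * deriv (fun y => u y t) x + (1/2) * (deriv (fun y => u y t) x)^2
          - (1/2) * b^2 * deriv (deriv (fun y => u y t)) x
          + a^2 / 2 + (1/2) * b^4 * (x^2 / 2 - 3 * (a * x + u x t) / b^2) := by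
  have hexp (n : ℕ) (s : ℝ) : Real.exp (b^2 * s / 2) ^ n = Real.exp (n * (b^2 * s / 2)) :=
    (Real.exp_nat_mul _ n).symm
  have hprofile (x t : ℝ) (h : 0 < 2 * Real.exp (b^2 * t / 2) - Real.exp (b^2 * T / 2)) :
      u x t = similarityProfile a b T (Real.exp (b^2 * T / 2)) x (Real.exp (b^2 * t / 2))
        (Real.log (2 * Real.exp (b^2 * t / 2) - Real.exp (b^2 * T / 2))) := by
    have h0 : Real.exp (-3 * b^2 * t / 2) = (Real.exp (b^2 * t / 2) ^ 3)⁻¹ := by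
      rw [hexp, ← Real.exp_neg]; congr 1; push_cast; ring
    have h1 : Real.exp (2 * b^2 * T) = Real.exp (b^2 * T / 2) ^ 4 := by
      rw [hexp]; congr 1; push_cast; ring
    have h2 : Real.exp (b^2 * (t + 3 * T) / 2)
        = Real.exp (b^2 * t / 2) * Real.exp (b^2 * T / 2) ^ 3 := by
      rw [hexp, ← Real.exp_add]; congr 1; push_cast; ring
    have h3 : Real.exp (2 * b^2 * t) = Real.exp (b^2 * t / 2) ^ 4 := by
      rw [hexp]; congr 1; push_cast; ring
    have h4 : Real.exp (b^2 * (t + T))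
        = Real.exp (b^2 * t / 2) ^ 2 * Real.exp (b^2 * T / 2) ^ 2 := by
      rw [hexp, hexp, ← Real.exp_add]; congr 1; push_cast; ring
    have h5 : Real.exp (b^2 * (3 * t + T) / 2)
        = Real.exp (b^2 * t / 2) ^ 3 * Real.exp (b^2 * T / 2) := by
      rw [hexp, ← Real.exp_add]; congr 1; push_cast; ring
    rw [hu x t h, h0, h1, h2, h3, h4, h5, similarityProfile, inv_div_left, ← div_eq_inv_mul,
      mul_comm (Real.exp (b^2 * t / 2) ^ 3) (96 * _ * _)]
  intro x t h
  have hux : deriv (fun y => u y t)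
      = fun y => similarityProfileDx a b (Real.exp (b^2 * T / 2)) y (Real.exp (b^2 * t / 2)) := by
    rw [funext fun y => hprofile y t h]
    exact funext fun y => (hasDerivAt_similarityProfile_x ..).deriv
  have hp : HasDerivAt (fun s => Real.exp (b^2 * s / 2))
      (b^2 / 2 * Real.exp (b^2 * t / 2)) t := by
    convert (((hasDerivAt_id' t).const_mul (b^2)).div_const 2).exp using 1
    ring
  have hd := (hp.const_mul 2).sub_const (Real.exp (b^2 * T / 2))
  have hl : HasDerivAt (fun s => Real.log (2 * Real.exp (b^2 * s / 2) - Real.exp (b^2 * T / 2)))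
      (b^2 * Real.exp (b^2 * t / 2) / (2 * Real.exp (b^2 * t / 2) - Real.exp (b^2 * T / 2))) t := by
    convert hd.log h.ne' using 1
    ring
  have hev : u x =ᶠ[nhds t] fun s =>
      similarityProfile a b T (Real.exp (b^2 * T / 2)) x (Real.exp (b^2 * s / 2))
        (Real.log (2 * Real.exp (b^2 * s / 2) - Real.exp (b^2 * T / 2))) :=
    (hd.continuousAt.eventually (lt_mem_nhds h)).mono fun s hs => hprofile x s hs
  rw [hux, hev.deriv_eq, (hasDerivAt_similarityProfileDx ..).deriv, hprofile x t h]
  exact (hasDerivAt_similarityProfile_t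
    (p := fun s => Real.exp (b^2 * s / 2)) hb (Real.exp_ne_zero _) h.ne' hp hl).deriv
end

section
/- Let a, b, T ∈ ℝ with b ≠ 0. Define u(x,t) = e^{−3b²t/2}/(96·b²·(2·e^{b²t/2} − e^{b²T/2})) · ( 3·b⁶·(e^{2b²T} − 2·e^{b²(t+3T)/2})·T − 96·a²·(e^{2b²T} − e^{b²(t+3T)/2}) − 96·b²·(e^{2b²T} − 2·e^{b²(t+3T)/2} + 2·a·e^{2b²t}·x − a·e^{b²(t+T)}·x − a·e^{b²(3t+T)/2}·x) + 4·b⁴·(2·e^{2b²T} + 3·e^{b²(t+T)} − 7·e^{b²(t+3T)/2} + 4·e^{2b²t}·(3x² − 2) − 2·e^{b²(3t+T)/2}·(6x² − 5)) − 6·b⁴·(e^{2b²T} − 2·e^{b²(t+3T)/2})·log(2·e^{b²t/2} − e^{b²T/2}) ). Then u satisfies the terminal condition u(x,T) = 1 for every x ∈ ℝ. -/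
/-- The similarity solution of the generalized Heath equation constructed
from the algebra A₄¹ satisfies the terminal condition u(x,T) = 1. -/
theorem terminal_similarity_solution_terminal_condition
    (a b T : ℝ) (hb : b ≠ 0) (u : ℝ → ℝ → ℝ)
    (hu : ∀ x t : ℝ,
      u x t = Real.exp (-3 * b^2 * t / 2) /
          (96 * b^2 * (2 * Real.exp (b^2 * t / 2) - Real.exp (b^2 * T / 2))) *
        (3 * b^6 * (Real.exp (2 * b^2 * T) - 2 * Real.exp (b^2 * (t + 3 * T) / 2)) * T
          - 96 * a^2 * (Real.exp (2 * b^2 * T) - Real.exp (b^2 * (t + 3 * T) / 2))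
          - 96 * b^2 * (Real.exp (2 * b^2 * T) - 2 * Real.exp (b^2 * (t + 3 * T) / 2)
              + 2 * a * Real.exp (2 * b^2 * t) * x - a * Real.exp (b^2 * (t + T)) * x
              - a * Real.exp (b^2 * (3 * t + T) / 2) * x)
          + 4 * b^4 * (2 * Real.exp (2 * b^2 * T) + 3 * Real.exp (b^2 * (t + T))
              - 7 * Real.exp (b^2 * (t + 3 * T) / 2)
              + 4 * Real.exp (2 * b^2 * t) * (3 * x^2 - 2)
              - 2 * Real.exp (b^2 * (3 * t + T) / 2) * (6 * x^2 - 5))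
          - 6 * b^4 * (Real.exp (2 * b^2 * T) - 2 * Real.exp (b^2 * (t + 3 * T) / 2))
              * Real.log (2 * Real.exp (b^2 * t / 2) - Real.exp (b^2 * T / 2)))) :
    ∀ x : ℝ, u x T = 1 := by
  intro x
  have h4 : ∀ y : ℝ, y = 2 * b ^ 2 * T → Real.exp y = Real.exp (b ^ 2 * T / 2) ^ 4 := by
    rintro y rfl
    rw [← Real.exp_nat_mul]
    congr 1
    push_cast
    ring
  have h3 : Real.exp (-3 * b ^ 2 * T / 2) = (Real.exp (b ^ 2 * T / 2) ^ 3)⁻¹ := by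
    rw [← Real.exp_nat_mul, ← Real.exp_neg]
    congr 1
    push_cast
    ring
  have hE : Real.exp (b ^ 2 * T / 2) ≠ 0 := Real.exp_ne_zero _
  have hlog : Real.log (2 * Real.exp (b ^ 2 * T / 2) - Real.exp (b ^ 2 * T / 2))
      = b ^ 2 * T / 2 := by
    rw [two_mul, add_sub_cancel_right, Real.log_exp]
  rw [hu, hlog, h3, h4 (2 * b ^ 2 * T) rfl, h4 (b ^ 2 * (T + 3 * T) / 2) (by ring),
    h4 (b ^ 2 * (T + T)) (by ring), h4 (b ^ 2 * (3 * T + T) / 2) (by ring),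
    two_mul (Real.exp (b ^ 2 * T / 2)), add_sub_cancel_right]
  generalize Real.exp (b ^ 2 * T / 2) = E at hE
  field_simp
  ring
end

section
/- Let a, b, α, A, β, K, T ∈ ℝ with b ≠ 0. Define u : ℝ × ℝ → ℝ by u(x,t) = (1/4)·((4·α + A·b²)·(x − β·K·e^{α(t−T)})² − 2·α·x²) − a·x. Then u satisfies the PDE u_t(x,t) = a·u_x(x,t) + (1/2)·u_x(x,t)² − (1/2)·b²·u_xx(x,t) + a²/2 − (1/2)·A·b²·(a·x + u(x,t)) + (1/4)·(2·α + A·b²)·(b² − α·x²) for all (x,t) ∈ ℝ². -/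
/-- The barrier-option similarity solution
u(x,t) = (1/4)((4α+Ab²)(x − βKe^{α(t−T)})² − 2αx²) − ax solves the generalized Heath
equation with f(x,u) = a²/2 − (1/2)Ab²(ax+u) + (1/4)(2α+Ab²)(b² − αx²). -/
theorem barrier_similarity_solution_solves_heath
    (a b α A β K T : ℝ) (hb : b ≠ 0) (u : ℝ → ℝ → ℝ)
    (hu : ∀ x t : ℝ, u x t =
      (1/4) * ((4 * α + A * b^2) * (x - β * K * Real.exp (α * (t - T)))^2
        - 2 * α * x^2) - a * x) :
    ∀ x t : ℝ, deriv (u x) t =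
      a * deriv (fun y => u y t) x + (1/2) * (deriv (fun y => u y t) x)^2
        - (1/2) * b^2 * deriv (deriv (fun y => u y t)) x
        + a^2 / 2 - (1/2) * A * b^2 * (a * x + u x t)
        + (1/4) * (2 * α + A * b^2) * (b^2 - α * x^2) := by
  intro x t
  have hux : ∀ y, HasDerivAt (fun z => u z t)
      ((1/2) * (4 * α + A * b^2) * (y - β * K * Real.exp (α * (t - T))) - α * y - a) y := by
    intro y
    simp only [hu]
    have h := (((((hasDerivAt_id' y).sub_const (β * K * Real.exp (α * (t - T)))).pow 2).const_mul
      (4 * α + A * b^2)).sub (((hasDerivAt_id' y).pow 2).const_mul (2 * α))).const_mul (1/4 : ℝ)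
    refine (h.sub ((hasDerivAt_id' y).const_mul a)).congr_deriv ?_
    push_cast
    ring
  have huxx : HasDerivAt (deriv fun z => u z t) ((1/2) * (4 * α + A * b^2) - α) x := by
    rw [show (deriv fun z => u z t) = _ from funext fun y => (hux y).deriv]
    have h := ((hasDerivAt_id' x).sub_const (β * K * Real.exp (α * (t - T)))).const_mul
      ((1/2) * (4 * α + A * b^2))
    refine ((h.sub ((hasDerivAt_id' x).const_mul α)).sub_const a).congr_deriv ?_
    ring
  have hut : HasDerivAt (u x) (-((1/2) * (4 * α + A * b^2) *
      (x - β * K * Real.exp (α * (t - T))) * (α * (β * K * Real.exp (α * (t - T)))))) t := by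
    rw [show u x = _ from funext (hu x)]
    have hexp := ((((hasDerivAt_id' t).sub_const T).const_mul α).exp).const_mul (β * K)
    have h := ((((hexp.const_sub x).pow 2).const_mul (4 * α + A * b^2)).sub_const
      (2 * α * x^2)).const_mul (1/4 : ℝ)
    refine (h.sub_const (a * x)).congr_deriv ?_
    push_cast
    ring
  rw [hut.deriv, huxx.deriv, (hux x).deriv, hu]
  ring
end

section
/- Let a, b, c₃ ∈ ℝ with b ≠ 0, and let D = {(x,t) ∈ ℝ² : x > 0 and cos((b²t − 2c₃)/4 + log x) ≠ 0}. Define u : D → ℝ by u(x,t) = −b²·log( e^{−x²/8}·√x·log(8·sec²((b²t − 2c₃)/4 + log x)) ) − a·x. Then u satisfies the PDE u_t(x,t) = a·u_x(x,t) + (1/2)·u_x(x,t)² − (1/2)·b²·u_xx(x,t) + (1/32)·( 16·a² + b⁴·( 8 − (4·√x·e^{P(x,t)} + x⁴ − 4)/x² ) ) on D, where P(x,t) = e^{x²/8 − (a·x + u(x,t))/b²}/√x + (a·x + u(x,t))/b² − x²/8. -/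
open Real in
theorem log_eight_mul_sec_sq {θ : ℝ} (h : cos θ ≠ 0) :
    log (8 * (1 / cos θ) ^ 2) = log 8 - 2 * log (cos θ) := by
  rw [log_mul (by norm_num) (by positivity), log_pow, one_div, log_inv]
  push_cast
  ring

open Real in
theorem log_eight_sub_two_mul_log_cos_pos (θ : ℝ) :
    0 < log 8 - 2 * log (cos θ) := by
  have h1 : log (cos θ) ≤ 0 := by
    rw [← log_abs]
    exact log_nonpos (abs_nonneg _) (abs_cos_le_one θ)
  have h2 : 0 < log 8 := log_pos (by norm_num)
  linarith

open Real in
theorem log_exp_mul_sqrt_mul {x L : ℝ} (hx : 0 < x) (hL : 0 < L) :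
    log (exp (-x ^ 2 / 8) * √x * L) = -x ^ 2 / 8 + log x / 2 + log L := by
  have hs : 0 < √x := sqrt_pos.2 hx
  rw [log_mul (by positivity) hL.ne', log_mul (exp_pos _).ne' hs.ne', log_exp, log_sqrt hx.le]

open Real in
theorem hasDerivAt_log_eight_sub_two_mul_log_cos {θ : ℝ → ℝ} {θ' s : ℝ}
    (hθ : HasDerivAt θ θ' s) (h : cos (θ s) ≠ 0) :
    HasDerivAt (fun r => log 8 - 2 * log (cos (θ r))) (2 * tan (θ s) * θ') s := by
  have := ((hθ.cos.log h).const_mul 2).const_sub (log 8)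
  refine this.congr_deriv ?_
  rw [tan_eq_sin_div_cos]
  ring

/-- The similarity solution obtained from the algebra A¹₂,₂,
u(x,t) = −b²·log(e^{−x²/8}√x·log(8·sec²((b²t−2c₃)/4 + log x))) − ax, solves the stated
generalized Heath equation on D = {(x,t) : x > 0 ∧ cos((b²t−2c₃)/4 + log x) ≠ 0}. -/
theorem A122_similarity_solution_solves_heath
    (a b c₃ : ℝ) (hb : b ≠ 0) (u : ℝ → ℝ → ℝ)
    (hu : ∀ x t : ℝ, 0 < x → Real.cos ((b^2 * t - 2 * c₃) / 4 + Real.log x) ≠ 0 →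
      u x t = -b^2 * Real.log (Real.exp (-x^2 / 8) * Real.sqrt x *
          Real.log (8 * (1 / Real.cos ((b^2 * t - 2 * c₃) / 4 + Real.log x))^2))
        - a * x) :
    ∀ x t : ℝ, 0 < x → Real.cos ((b^2 * t - 2 * c₃) / 4 + Real.log x) ≠ 0 →
      deriv (u x) t =
        a * deriv (fun y => u y t) x + (1/2) * (deriv (fun y => u y t) x)^2
          - (1/2) * b^2 * deriv (deriv (fun y => u y t)) x
          + (1/32) * (16 * a^2 + b^4 * (8 -
            (4 * Real.sqrt x *
              Real.exp (Real.exp (x^2 / 8 - (a * x + u x t) / b^2) / Real.sqrt x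
                + (a * x + u x t) / b^2 - x^2 / 8)
              + x^4 - 4) / x^2)) := by
  intro x t hx hc
  have hx0 : x ≠ 0 := hx.ne'
  set θ : ℝ → ℝ → ℝ := fun y s => (b ^ 2 * s - 2 * c₃) / 4 + Real.log y with hθ
  set L : ℝ → ℝ → ℝ := fun y s => Real.log 8 - 2 * Real.log (Real.cos (θ y s)) with hL
  have hLpos : ∀ y s, 0 < L y s := fun y s => log_eight_sub_two_mul_log_cos_pos (θ y s)
  have hu' : ∀ y s, 0 < y → Real.cos (θ y s) ≠ 0 →
      u y s = -b ^ 2 * (-y ^ 2 / 8 + Real.log y / 2 + Real.log (L y s)) - a * y := by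
    intro y s hy h
    rw [hu y s hy h, log_eight_mul_sec_sq h, log_exp_mul_sqrt_mul hy (hLpos y s)]
  have hθx : ∀ y, 0 < y → HasDerivAt (fun z => θ z t) (1 / y) y := fun y hy => by
    simpa only [one_div] using (Real.hasDerivAt_log hy.ne').const_add ((b ^ 2 * t - 2 * c₃) / 4)
  have hθt : HasDerivAt (fun s => θ x s) (b ^ 2 / 4) t := by
    simpa only [mul_one] using ((((hasDerivAt_id' t).const_mul (b ^ 2)).sub_const (2 * c₃)).div_const
      4).add_const (Real.log x)
  have hLx : ∀ y, 0 < y → Real.cos (θ y t) ≠ 0 →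
      HasDerivAt (fun z => L z t) (2 * Real.tan (θ y t) * (1 / y)) y := fun y hy h =>
    hasDerivAt_log_eight_sub_two_mul_log_cos (hθx y hy) h
  have hLt : HasDerivAt (fun s => L x s) (2 * Real.tan (θ x t) * (b ^ 2 / 4)) t :=
    hasDerivAt_log_eight_sub_two_mul_log_cos hθt hc
  have hnear : ∀ y, 0 < y → Real.cos (θ y t) ≠ 0 →
      ∀ᶠ z in nhds y, 0 < z ∧ Real.cos (θ z t) ≠ 0 := fun y hy h =>
    (eventually_gt_nhds hy).and ((hθx y hy).cos.continuousAt.eventually_ne h)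
  have hux : ∀ y, 0 < y → Real.cos (θ y t) ≠ 0 → deriv (fun z => u z t) y =
      b ^ 2 * (y / 4 - 1 / (2 * y) - 2 * Real.tan (θ y t) / (y * L y t)) - a := by
    intro y hy h
    have hl := hLpos y t
    have hd : HasDerivAt
        (fun z => -b ^ 2 * (-z ^ 2 / 8 + Real.log z / 2 + Real.log (L z t)) - a * z)
        (b ^ 2 * (y / 4 - 1 / (2 * y) - 2 * Real.tan (θ y t) / (y * L y t)) - a) y := by
      have := ((((((hasDerivAt_pow 2 y).fun_neg.div_const 8).fun_add
        ((Real.hasDerivAt_log hy.ne').div_const 2)).fun_add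
        ((hLx y hy h).log hl.ne')).const_mul (-b ^ 2)).fun_sub ((hasDerivAt_id' y).const_mul a))
      refine this.congr_deriv ?_
      field_simp
      push_cast
      ring
    refine (hd.congr_of_eventuallyEq ?_).deriv
    filter_upwards [hnear y hy h] with z hz using hu' z t hz.1 hz.2
  have hl := hLpos x t
  have hut : deriv (u x) t = -b ^ 4 * Real.tan (θ x t) / (2 * L x t) := by
    have hd : HasDerivAt
        (fun s => -b ^ 2 * (-x ^ 2 / 8 + Real.log x / 2 + Real.log (L x s)) - a * x)
        (-b ^ 4 * Real.tan (θ x t) / (2 * L x t)) t := by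
      have := (((hLt.log hl.ne').const_add (-x ^ 2 / 8 + Real.log x / 2)).const_mul
        (-b ^ 2)).sub_const (a * x)
      refine this.congr_deriv ?_
      field_simp
      ring
    refine (hd.congr_of_eventuallyEq ?_).deriv
    filter_upwards [hθt.cos.continuousAt.eventually_ne hc] with s hs using hu' x s hx hs
  have huxx : deriv (deriv (fun z => u z t)) x =
      b ^ 2 * (1 / 4 + 1 / (2 * x ^ 2) - (2 / Real.cos (θ x t) ^ 2 / (x ^ 2 * L x t)
        - 2 * Real.tan (θ x t) / (x ^ 2 * L x t)
        - 4 * Real.tan (θ x t) ^ 2 / (x ^ 2 * L x t ^ 2))) := by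
    have htan : HasDerivAt (fun z => Real.tan (θ z t)) (1 / Real.cos (θ x t) ^ 2 * (1 / x)) x :=
      HasDerivAt.comp x (h := fun z => θ z t) (Real.hasDerivAt_tan hc) (hθx x hx)
    have hd : HasDerivAt
        (fun y => b ^ 2 * (y / 4 - 1 / (2 * y) - 2 * Real.tan (θ y t) / (y * L y t)) - a)
        (b ^ 2 * (1 / 4 + 1 / (2 * x ^ 2) - (2 / Real.cos (θ x t) ^ 2 / (x ^ 2 * L x t)
          - 2 * Real.tan (θ x t) / (x ^ 2 * L x t)
          - 4 * Real.tan (θ x t) ^ 2 / (x ^ 2 * L x t ^ 2)))) x := by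
      have := ((((((hasDerivAt_id' x).div_const 4).fun_sub
        ((hasDerivAt_const x (1 : ℝ)).fun_div ((hasDerivAt_id' x).const_mul 2)
          (by positivity))).fun_sub
        ((htan.const_mul 2).fun_div ((hasDerivAt_id' x).fun_mul (hLx x hx hc))
          (by positivity))).const_mul (b ^ 2)).sub_const a)
      refine this.congr_deriv ?_
      generalize Real.tan (θ x t) = T
      generalize Real.cos (θ x t) = C at hc
      generalize L x t = l at hl
      have hl0 := hl.ne'
      field_simp
      ring
    refine (hd.congr_of_eventuallyEq ?_).deriv
    filter_upwards [hnear x hx hc] with z hz using hux z hz.1 hz.2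
  have hs : 0 < Real.sqrt x := Real.sqrt_pos.2 hx
  have hlog : (a * x + u x t) / b ^ 2 =
      -(-x ^ 2 / 8 + Real.log x / 2 + Real.log (L x t)) := by
    rw [hu' x t hx hc]
    field_simp
    ring
  have hinner : Real.exp (x ^ 2 / 8 - (a * x + u x t) / b ^ 2) = Real.sqrt x * L x t := by
    rw [hlog, ← Real.log_sqrt hx.le, show x ^ 2 / 8 - -(-x ^ 2 / 8 + Real.log (Real.sqrt x) +
      Real.log (L x t)) = Real.log (Real.sqrt x) + Real.log (L x t) by ring, Real.exp_add,
      Real.exp_log hs, Real.exp_log hl]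
  have hP : 4 * Real.sqrt x *
      Real.exp (Real.exp (x ^ 2 / 8 - (a * x + u x t) / b ^ 2) / Real.sqrt x
        + (a * x + u x t) / b ^ 2 - x ^ 2 / 8) = 32 / (Real.cos (θ x t) ^ 2 * L x t) := by
    have hsec : Real.exp (L x t) = 8 * (1 / Real.cos (θ x t)) ^ 2 := by
      rw [← Real.exp_log (show 0 < 8 * (1 / Real.cos (θ x t)) ^ 2 by positivity),
        log_eight_mul_sec_sq hc]
    rw [hinner, hlog, mul_div_cancel_left₀ _ hs.ne', ← Real.log_sqrt hx.le,
      show L x t + -(-x ^ 2 / 8 + Real.log (Real.sqrt x) + Real.log (L x t)) - x ^ 2 / 8 =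
        L x t - Real.log (Real.sqrt x) - Real.log (L x t) by ring, Real.exp_sub, Real.exp_sub,
      Real.exp_log hs, Real.exp_log hl, hsec]
    field_simp
    norm_num
  rw [hP, hut, huxx, hux x hx hc]
  change Real.cos (θ x t) ≠ 0 at hc
  generalize Real.tan (θ x t) = T
  generalize Real.cos (θ x t) = C at hc
  generalize L x t = l at hl
  have hl0 := hl.ne'
  field_simp
  ring
end

section
/- Let a, b, c₁ ∈ ℝ with b ≠ 0, and let D = {(x,t) ∈ ℝ² : 3·b²·t − 6·c₁ + x ≠ 0}. Define u : D → ℝ by u(x,t) = −b²·log( (3/2)·e^{−3x}·( 4/(3·b²·t − 6·c₁ + x)² + 3 ) ) − a·x. Then u satisfies the PDE u_t(x,t) = a·u_x(x,t) + (1/2)·u_x(x,t)² − (1/2)·b²·u_xx(x,t) + (1/8)·( 4·a² − b⁴·( 77·sinh((a·x − 3·b²·x + u(x,t))/b²) + 85·cosh((a·x − 3·b²·x + u(x,t))/b²) ) ) on D. -/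
/-- Derivative of `log (4 / s ^ 2 + 3)`, composed with a function `s`. -/
theorem hasDerivAt_log_four_div_sq_add_three {s : ℝ → ℝ} {s' y : ℝ} (hs : HasDerivAt s s' y)
    (h0 : s y ≠ 0) :
    HasDerivAt (fun z => Real.log (4 / s z ^ 2 + 3)) (-8 * s' / (s y * (4 + 3 * s y ^ 2))) y := by
  have hP : 4 / s y ^ 2 + 3 ≠ 0 := by positivity
  have hQ : 4 + 3 * s y ^ 2 ≠ 0 := by positivity
  have h := (((hasDerivAt_const y (4 : ℝ)).fun_div (hs.fun_pow 2) (pow_ne_zero 2 h0)).add_const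
    (3 : ℝ)).log hP
  refine h.congr_deriv ?_
  have hP' : 4 / s y ^ 2 + 3 = (4 + 3 * s y ^ 2) / s y ^ 2 := by field_simp
  rw [hP']
  push_cast
  field_simp
  ring

/-- Derivative of `-8 / (s * (4 + 3 * s ^ 2))`, composed with a function `s` of unit slope. -/
theorem hasDerivAt_neg_eight_div {s : ℝ → ℝ} {y : ℝ} (hs : HasDerivAt s 1 y) (h0 : s y ≠ 0) :
    HasDerivAt (fun z => -8 / (s z * (4 + 3 * s z ^ 2)))
      (8 * (4 + 9 * s y ^ 2) / (s y * (4 + 3 * s y ^ 2)) ^ 2) y := by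
  have hQ : 4 + 3 * s y ^ 2 ≠ 0 := by positivity
  have h := (hasDerivAt_const y (-8 : ℝ)).fun_div
    (hs.fun_mul (((hs.fun_pow 2).const_mul 3).const_add 4)) (mul_ne_zero h0 hQ)
  refine h.congr_deriv ?_
  push_cast
  field_simp
  ring

/-- The logarithm in the similarity solution, split into summands. -/
theorem log_three_halves_mul_exp_mul (x s : ℝ) :
    Real.log ((3/2) * Real.exp (-3 * x) * (4 / s ^ 2 + 3)) =
      Real.log (3/2) + -3 * x + Real.log (4 / s ^ 2 + 3) := by
  have hP : 4 / s ^ 2 + 3 ≠ 0 := by positivity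
  rw [Real.log_mul (by positivity) hP, Real.log_mul (by norm_num) (Real.exp_ne_zero _),
    Real.log_exp]


/-- The similarity solution obtained from the algebra A⁹₃,₅,
u(x,t) = −b²·log((3/2)e^{−3x}(4/(3b²t − 6c₁ + x)² + 3)) − ax, solves the stated
generalized Heath equation on D = {(x,t) : 3b²t − 6c₁ + x ≠ 0}. -/
theorem A935_similarity_solution_solves_heath
    (a b c₁ : ℝ) (hb : b ≠ 0) (u : ℝ → ℝ → ℝ)
    (hu : ∀ x t : ℝ, 3 * b^2 * t - 6 * c₁ + x ≠ 0 →
      u x t = -b^2 * Real.log ((3/2) * Real.exp (-3 * x) *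
          (4 / (3 * b^2 * t - 6 * c₁ + x)^2 + 3)) - a * x) :
    ∀ x t : ℝ, 3 * b^2 * t - 6 * c₁ + x ≠ 0 →
      deriv (u x) t =
        a * deriv (fun y => u y t) x + (1/2) * (deriv (fun y => u y t) x)^2
          - (1/2) * b^2 * deriv (deriv (fun y => u y t)) x
          + (1/8) * (4 * a^2 - b^4 *
            (77 * Real.sinh ((a * x - 3 * b^2 * x + u x t) / b^2)
              + 85 * Real.cosh ((a * x - 3 * b^2 * x + u x t) / b^2))) := by
  intro x t h
  have hsx (y : ℝ) : HasDerivAt (fun z => 3 * b^2 * t - 6 * c₁ + z) 1 y :=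
    (hasDerivAt_id y).const_add _
  have hst : HasDerivAt (fun τ => 3 * b^2 * τ - 6 * c₁ + x) (3 * b^2) t := by
    simpa using (((hasDerivAt_id t).const_mul (3 * b^2)).sub_const (6 * c₁)).add_const x
  have hut : HasDerivAt (u x) (-b^2 * (-8 * (3 * b^2) / ((3 * b^2 * t - 6 * c₁ + x) *
      (4 + 3 * (3 * b^2 * t - 6 * c₁ + x)^2)))) t := by
    refine ((((hasDerivAt_log_four_div_sq_add_three hst h).const_add
      (Real.log (3/2) + -3 * x)).const_mul (-b^2)).sub_const (a * x)).congr_of_eventuallyEq ?_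
    filter_upwards [hst.continuousAt.eventually_ne h] with τ hτ
    rw [hu x τ hτ, log_three_halves_mul_exp_mul]
  have hux (y : ℝ) (hy : 3 * b^2 * t - 6 * c₁ + y ≠ 0) : HasDerivAt (fun z => u z t)
      (-b^2 * (-3 + -8 / ((3 * b^2 * t - 6 * c₁ + y) *
        (4 + 3 * (3 * b^2 * t - 6 * c₁ + y)^2))) - a) y := by
    have hlin : HasDerivAt (fun z : ℝ => Real.log (3/2) + -3 * z) (-3) y := by
      simpa using ((hasDerivAt_id y).const_mul (-3 : ℝ)).const_add (Real.log (3/2))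
    have hax : HasDerivAt (fun z : ℝ => a * z) a y := by
      simpa using (hasDerivAt_id y).const_mul a
    have hd := ((hlin.fun_add (hasDerivAt_log_four_div_sq_add_three (hsx y) hy)).const_mul
      (-b^2)).fun_sub hax
    rw [mul_one] at hd
    refine hd.congr_of_eventuallyEq ?_
    filter_upwards [(hsx y).continuousAt.eventually_ne hy] with z hz
    rw [hu z t hz, log_three_halves_mul_exp_mul]
  have huxx : HasDerivAt (deriv fun y => u y t)
      (-b^2 * (8 * (4 + 9 * (3 * b^2 * t - 6 * c₁ + x)^2) / ((3 * b^2 * t - 6 * c₁ + x) *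
        (4 + 3 * (3 * b^2 * t - 6 * c₁ + x)^2))^2)) x := by
    refine ((((hasDerivAt_neg_eight_div (hsx x) h).const_add (-3)).const_mul
      (-b^2)).sub_const a).congr_of_eventuallyEq ?_
    filter_upwards [(hsx x).continuousAt.eventually_ne h] with z hz
    exact (hux z hz).deriv
  have harg : (a * x - 3 * b^2 * x + u x t) / b^2 =
      -Real.log (3/2 * (4 / (3 * b^2 * t - 6 * c₁ + x)^2 + 3)) := by
    rw [hu x t h, log_three_halves_mul_exp_mul, Real.log_mul (by norm_num) (by positivity)]
    field_simp
    ring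
  rw [hut.deriv, (hux x h).deriv, huxx.deriv, harg, Real.sinh_eq, Real.cosh_eq, neg_neg,
    Real.exp_neg, Real.exp_log (by positivity)]
  generalize 3 * b^2 * t - 6 * c₁ + x = s at h ⊢
  have hQ : 4 + 3 * s^2 ≠ 0 := by positivity
  have hP : 4 / s^2 + 3 = (4 + 3 * s^2) / s^2 := by field_simp
  rw [hP]
  field_simp
  ring
end

section
/- Let b, α, β, K, T ∈ ℝ with b ≠ 0, α ≠ 0, β ≠ 0, K ≠ 0, and let F : ℝ → ℝ be continuously differentiable. Define φ : ℝ × ℝ → ℝ by φ(x,τ) = e^{α·x²/(2b²)}·F( b²·e^{−2ατ/b² − αT}·( e^{2ατ/b² + αT}·x − K·β )/(2·α·β·K) ). Then φ satisfies the invariant surface condition b⁴·e^{α(2τ + b²T)/b²}·φ_τ(x,τ) + 2·α·β·K·( α·x·φ(x,τ) − b²·φ_x(x,τ) ) = 0 for all (x,τ) ∈ ℝ². -/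
/-- The self-similar ansatz
φ(x,τ) = e^{αx²/(2b²)}·F(b²e^{−2ατ/b²−αT}(e^{2ατ/b²+αT}x − Kβ)/(2αβK)) satisfies the
invariant surface condition b⁴e^{α(2τ+b²T)/b²}φ_τ + 2αβK(αxφ − b²φ_x) = 0. -/
theorem invariant_surface_condition_barrier
    (b α β K T : ℝ) (hb : b ≠ 0) (hα : α ≠ 0) (hβ : β ≠ 0) (hK : K ≠ 0)
    (F : ℝ → ℝ) (hF : ContDiff ℝ 1 F)
    (φ : ℝ → ℝ → ℝ)
    (hφ : ∀ x τ : ℝ, φ x τ = Real.exp (α * x^2 / (2 * b^2)) *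
      F (b^2 * Real.exp (-2 * α * τ / b^2 - α * T) *
        (Real.exp (2 * α * τ / b^2 + α * T) * x - K * β) / (2 * α * β * K))) :
    ∀ x τ : ℝ, b^4 * Real.exp (α * (2 * τ + b^2 * T) / b^2) * deriv (φ x) τ
      + 2 * α * β * K * (α * x * φ x τ - b^2 * deriv (fun y => φ y τ) x) = 0 := by
  intro x τ
  have hexp (t : ℝ) : Real.exp (-2 * α * t / b^2 - α * T) *
      Real.exp (2 * α * t / b^2 + α * T) = 1 := by
    rw [← Real.exp_add, Real.exp_eq_one_iff]
    ring
  have hφ' (y t : ℝ) : φ y t = Real.exp (α * y^2 / (2 * b^2)) *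
      F (b^2 / (2 * α * β * K) * y
        - b^2 / (2 * α) * Real.exp (-2 * α * t / b^2 - α * T)) := by
    rw [hφ]
    congr 2
    have h := hexp t
    generalize Real.exp (-2 * α * t / b^2 - α * T) = P at h ⊢
    generalize Real.exp (2 * α * t / b^2 + α * T) = Q at h ⊢
    field_simp
    linear_combination y * h
  have hF' (z : ℝ) : HasDerivAt F (deriv F z) z :=
    (hF.differentiable one_ne_zero z).hasDerivAt
  have hE : HasDerivAt (fun t : ℝ => Real.exp (-2 * α * t / b^2 - α * T))
      (Real.exp (-2 * α * τ / b^2 - α * T) * (-2 * α * 1 / b^2)) τ :=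
    ((((hasDerivAt_id τ).const_mul (-2 * α)).div_const (b^2)).sub_const (α * T)).exp
  have hG : HasDerivAt (fun y : ℝ => Real.exp (α * y^2 / (2 * b^2)))
      (Real.exp (α * x^2 / (2 * b^2)) * (α * (2 * x) / (2 * b^2))) x := by
    simpa using (((hasDerivAt_pow 2 x).const_mul α).div_const (2 * b^2)).exp
  have hτ := ((hF' _).comp τ ((hE.const_mul (b^2 / (2 * α))).const_sub
    (b^2 / (2 * α * β * K) * x))).const_mul (Real.exp (α * x^2 / (2 * b^2)))
  have hx := hG.mul ((hF' _).comp x ((((hasDerivAt_id x).const_mul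
    (b^2 / (2 * α * β * K))).sub_const
      (b^2 / (2 * α) * Real.exp (-2 * α * τ / b^2 - α * T)))))
  have hτ' := (hτ.congr_of_eventuallyEq (.of_forall (hφ' x))).deriv
  have hx' := (hx.congr_of_eventuallyEq (.of_forall fun y => hφ' y τ)).deriv
  have hA : Real.exp (α * (2 * τ + b^2 * T) / b^2) =
      Real.exp (2 * α * τ / b^2 + α * T) := by
    congr 1
    field_simp
  have h := hexp τ
  rw [hτ', hx', hφ', hA]
  simp only [Function.comp_apply, id]
  set z := b^2 / (2 * α * β * K) * x
    - b^2 / (2 * α) * Real.exp (-2 * α * τ / b^2 - α * T)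
  generalize deriv F z = D
  generalize F z = f
  generalize Real.exp (α * x^2 / (2 * b^2)) = G
  generalize Real.exp (-2 * α * τ / b^2 - α * T) = P at h ⊢
  generalize Real.exp (2 * α * τ / b^2 + α * T) = Q at h ⊢
  field_simp
  linear_combination (G * b^4 * D) * h
end

section
/- Let A, B, c₁, c₃, c₄, c₅ ∈ ℝ with c₁ ≠ 0, B ≠ 0 and D := A² − 16·B > 0. Define H : ℝ → ℝ by H(τ) = ( e^{(A − √D)·τ/2}/(2·B·c₁) )·( √D·( c₃ − e^{√D·τ}·c₄ ) + A·( c₃ + e^{√D·τ}·c₄ ) ) + c₅. Then H is differentiable and satisfies the ordinary differential equation 4·e^{(A − √D)·τ/2}·( c₃ + e^{√D·τ}·c₄ ) − c₁·H′(τ) = 0 for all τ ∈ ℝ. -/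
/-- The barrier function
H(τ) = (e^{(A−√D)τ/2}/(2Bc₁))·(√D(c₃ − e^{√D·τ}c₄) + A(c₃ + e^{√D·τ}c₄)) + c₅, with
D = A² − 16B > 0, is differentiable and solves the invariance ODE
4e^{(A−√D)τ/2}(c₃ + e^{√D·τ}c₄) − c₁H′(τ) = 0. -/
theorem barrier_function_solves_invariance_ODE
    (A B c₁ c₃ c₄ c₅ : ℝ) (hc₁ : c₁ ≠ 0) (hB : B ≠ 0)
    (hD : 0 < A^2 - 16 * B)
    (H : ℝ → ℝ)
    (hH : ∀ τ : ℝ, H τ =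
      (Real.exp ((A - Real.sqrt (A^2 - 16 * B)) * τ / 2) / (2 * B * c₁)) *
        (Real.sqrt (A^2 - 16 * B) * (c₃ - Real.exp (Real.sqrt (A^2 - 16 * B) * τ) * c₄)
          + A * (c₃ + Real.exp (Real.sqrt (A^2 - 16 * B) * τ) * c₄)) + c₅) :
    Differentiable ℝ H ∧
    ∀ τ : ℝ, 4 * Real.exp ((A - Real.sqrt (A^2 - 16 * B)) * τ / 2) *
        (c₃ + Real.exp (Real.sqrt (A^2 - 16 * B) * τ) * c₄) - c₁ * deriv H τ = 0 := by
  have hs : Real.sqrt (A^2 - 16 * B) ^ 2 = A^2 - 16 * B := Real.sq_sqrt hD.le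
  generalize Real.sqrt (A^2 - 16 * B) = s at hs hH ⊢
  have key : ∀ τ : ℝ, HasDerivAt H
      (4 * Real.exp ((A - s) * τ / 2) * (c₃ + Real.exp (s * τ) * c₄) / c₁) τ := by
    intro τ
    have hE : HasDerivAt (fun t : ℝ => Real.exp ((A - s) * t / 2))
        (Real.exp ((A - s) * τ / 2) * ((A - s) * 1 / 2)) τ :=
      (((hasDerivAt_id τ).const_mul (A - s)).div_const 2).exp
    have hF : HasDerivAt (fun t : ℝ => Real.exp (s * t) * c₄)
        (Real.exp (s * τ) * (s * 1) * c₄) τ :=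
      (((hasDerivAt_id τ).const_mul s).exp).mul_const c₄
    rw [funext hH]
    refine (((hE.div_const (2 * B * c₁)).mul
      (((hF.const_sub c₃).const_mul s).add ((hF.const_add c₃).const_mul A))).add_const
        c₅).congr_deriv ?_
    simp only [Pi.add_apply]
    field_simp
    linear_combination (-(c₃ + Real.exp (s * τ) * c₄)) * hs
  refine ⟨fun τ => (key τ).differentiableAt, fun τ => ?_⟩
  rw [(key τ).deriv, mul_div_cancel₀ _ hc₁, sub_self]
end

section
/- Let A, b, α, β, K, T, c₃ ∈ ℝ with b ≠ 0, α ≠ 0, β ≠ 0, K ≠ 0, c₃ ≠ 0 and A·b² + 4·α > 0 and A·b² + 2·α ≠ 0. Set B = −(b²·α·A + 2·α²)/(2·b⁴), c₁ = −2·b²·e^{αT}·c₃/(α·β·K), c₄ = 0, c₅ = 0, and D = A² − 16·B. Then D = (A + 4α/b²)² > 0, and the barrier function H(τ) = ( e^{(A − √D)·τ/2}/(2·B·c₁) )·( √D·( c₃ − e^{√D·τ}·c₄ ) + A·( c₃ + e^{√D·τ}·c₄ ) ) + c₅ equals the standard exponential barrier: H(τ) = K·β·e^{−2α(τ + b²T/2)/b²}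 for all τ ∈ ℝ. -/
/-- With B = −(b²αA + 2α²)/(2b⁴), c₁ = −2b²e^{αT}c₃/(αβK), c₄ = c₅ = 0
and D = A² − 16B, one has D = (A + 4α/b²)² > 0, and the general barrier function reduces
to the standard exponential barrier H(τ) = Kβe^{−2α(τ + b²T/2)/b²}. -/
theorem barrier_function_standard_exponential_form
    (A b α β K T c₃ B c₁ c₄ c₅ D : ℝ)
    (hb : b ≠ 0) (hα : α ≠ 0) (hβ : β ≠ 0) (hK : K ≠ 0) (hc₃ : c₃ ≠ 0)
    (h4α : 0 < A * b^2 + 4 * α) (h2α : A * b^2 + 2 * α ≠ 0)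
    (hB : B = -(b^2 * α * A + 2 * α^2) / (2 * b^4))
    (hc₁ : c₁ = -2 * b^2 * Real.exp (α * T) * c₃ / (α * β * K))
    (hc₄ : c₄ = 0) (hc₅ : c₅ = 0)
    (hD : D = A^2 - 16 * B)
    (H : ℝ → ℝ)
    (hH : ∀ τ : ℝ, H τ =
      (Real.exp ((A - Real.sqrt D) * τ / 2) / (2 * B * c₁)) *
        (Real.sqrt D * (c₃ - Real.exp (Real.sqrt D * τ) * c₄)
          + A * (c₃ + Real.exp (Real.sqrt D * τ) * c₄)) + c₅) :
    D = (A + 4 * α / b^2)^2 ∧ 0 < D ∧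
    ∀ τ : ℝ, H τ = K * β * Real.exp (-2 * α * (τ + b^2 * T / 2) / b^2) := by
  have hD' : D = (A + 4 * α / b^2)^2 := by
    rw [hD, hB]
    field_simp
    ring
  have hpos : 0 < A + 4 * α / b^2 := by
    have h : A + 4 * α / b^2 = (A * b^2 + 4 * α) / b^2 := by field_simp
    rw [h]
    positivity
  have hsqrt : Real.sqrt D = A + 4 * α / b^2 := by
    rw [hD', Real.sqrt_sq hpos.le]
  refine ⟨hD', by rw [hD']; positivity, fun τ => ?_⟩
  have hexp : Real.exp ((A - (A + 4 * α / b^2)) * τ / 2)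
      = Real.exp (-2 * α * (τ + b^2 * T / 2) / b^2) * Real.exp (α * T) := by
    rw [← Real.exp_add]
    congr 1
    field_simp
    ring
  have hden : 2 * B * c₁
      = 2 * (A * b^2 + 2 * α) * Real.exp (α * T) * c₃ / (b^2 * β * K) := by
    rw [hB, hc₁]
    field_simp
  have hnum : (A + 4 * α / b^2) * c₃ + A * c₃ = 2 * (A * b^2 + 2 * α) * c₃ / b^2 := by
    field_simp
    ring
  rw [hH, hc₄, hc₅, hsqrt, hexp, hden]
  simp only [mul_zero, sub_zero, add_zero]
  rw [hnum]
  have hT : Real.exp (α * T) ≠ 0 := Real.exp_ne_zero _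
  generalize Real.exp (α * T) = E at *
  generalize Real.exp (-2 * α * (τ + b^2 * T / 2) / b^2) = F at *
  generalize A * b^2 + 2 * α = G at *
  field_simp
end
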